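/- Exact-order characterization of arbitrage (combining Theorems 1 and 2): fix an agent i, an order k ≥ 0, and a strategy a_i ∈ UD_i^k \ UD_i^{k+1} (a response of exact order k). Then for every order m ≥ 0, the strategy a_i is dominated relative to ∏_{j≠i} UD_j^m if and only if m ≥ k. In other words, an agent who anticipated the market to use undominated responses of order k has a tradeable arbitrage opportunity against a market using undominated responses of order m precisely when the market uses level k or higher (k+1 or higher levels of the belief hierarchy in the paper's counting). -/

import Mathlib

open MeasureTheory
open scoped Classical

namespace ArbitrageBeliefs

variable {I : Type*} {A : I → Type*} {S : Type*}

/-- Splice agent `i`'s strategy `ai` together with a profile `b` of the other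
agents' strategies into a full strategy profile. -/
noncomputable def splice (i : I) (ai : A i)
    (b : ∀ j : {j : I // j ≠ i}, A j.1) : ∀ j, A j := fun j =>
  if h : j = i then h.symm ▸ ai else b ⟨j, h⟩

/-- Agent `i`'s strategy `ai` is dominated relative to a set `T` of profiles of
the other agents' strategies: against every profile in `T` there is an
alternative strategy that gives `P`-a.s. weakly higher utility and strictly
higher utility with positive probability. -/
def Dominated [MeasurableSpace S] (P : Measure S)
    (Ui : (∀ j, A j) → S → ℝ) (i : I) (ai : A i)
    (T : Set (∀ j : {j : I // j ≠ i}, A j.1)) : Prop :=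
  ∀ b ∈ T, ∃ ai' : A i,
    (∀ᵐ s ∂P, Ui (splice i ai b) s ≤ Ui (splice i ai' b) s) ∧
    0 < P {s | Ui (splice i ai b) s < Ui (splice i ai' b) s}

/-- The undominated response sets, defined by simultaneous recursion:
`UD P U 0 i = A i` and
`UD P U (k+1) i = {ai ∈ UD P U k i : ai not dominated rel. ∏_{j ≠ i} UD P U k j}`. -/
def UD [MeasurableSpace S] (P : Measure S)
    (U : ∀ i : I, (∀ j, A j) → S → ℝ) : ℕ → ∀ i, Set (A i)
  | 0 => fun _ => Set.univ
  | (k + 1) => fun i =>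
      {ai | ai ∈ UD P U k i ∧
        ¬ Dominated P (U i) i ai {b | ∀ j, b j ∈ UD P U k j.1}}

/-- The product set `∏_{j ≠ i} UD_j^k` of the other agents' undominated
`k`-th order responses. -/
def PiUD [MeasurableSpace S] (P : Measure S)
    (U : ∀ i : I, (∀ j, A j) → S → ℝ) (k : ℕ) (i : I) :
    Set (∀ j : {j : I // j ≠ i}, A j.1) :=
  {b | ∀ j, b j ∈ UD P U k j.1}

theorem Dominated.mono [MeasurableSpace S] {P : Measure S}
    {Ui : (∀ j, A j) → S → ℝ} {i : I} {ai : A i}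
    {T T' : Set (∀ j : {j : I // j ≠ i}, A j.1)}
    (h : Dominated P Ui i ai T) (hT : T' ⊆ T) : Dominated P Ui i ai T' :=
  fun b hb => h b (hT hb)

theorem UD_antitone [MeasurableSpace S] (P : Measure S)
    (U : ∀ i : I, (∀ j, A j) → S → ℝ) (i : I) : Antitone fun k => UD P U k i :=
  antitone_nat_of_succ_le fun _ _ h => h.1

/-- exact-order characterization: if `a_i ∈ UD_i^k \\ UD_i^{k+1}`
(a response of exact order `k`), then for every `m`, `a_i` is dominated relative to
`∏_{j≠i} UD_j^m` if and only if `m ≥ k`. -/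
theorem exact_order_arbitrage_iff [Fintype I] [∀ i, Nonempty (A i)]
    [MeasurableSpace S] (P : Measure S) [IsProbabilityMeasure P]
    (U : ∀ i : I, (∀ j, A j) → S → ℝ)
    (hU : ∀ (i : I) (a : ∀ j, A j), Measurable (U i a))
    (i : I) (k : ℕ) (ai : A i)
    (hai : ai ∈ UD P U k i \ UD P U (k + 1) i) :
    ∀ m : ℕ, Dominated P (U i) i ai (PiUD P U m i) ↔ k ≤ m := by
  intro m
  constructor
  · intro hd
    by_contra! hlt
    exact (UD_antitone P U i hlt hai.1).2 hd
  · intro hkm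
    have hd : Dominated P (U i) i ai (PiUD P U k i) := by
      by_contra hnd
      exact hai.2 ⟨hai.1, hnd⟩
    exact hd.mono fun b hb j => UD_antitone P U j.1 hkm (hb j)

end ArbitrageBeliefs
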